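/- Fischer decomposition for the discrete Laplacian: let k ≥ 0, h > 0, and fix a sign choice. For every P ∈ Π_k^± there exist lattice functions 𝓗_{k−2s} ∈ Π_{k−2s}^± with Δ_h 𝓗_{k−2s} = 0, for 0 ≤ 2s ≤ k, such that P = Σ_{2s ≤ k} |mh|^{2s} · 𝓗_{k−2s}, where |mh|² := (m₁h)² + (m₂h)² + (m₃h)² and |mh|^{2s}·𝓗 denotes the lattice function m ↦ |mh|^{2s}·𝓗(m). -/

import Mathlib

open Finset Quaternion

noncomputable section

/-- Forward/backward difference `∂_h^{±l}` on the lattice `ℤ³`. -/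
def pd {A : Type*} [AddCommGroup A] [Module ℝ A] (σ : Bool) (h : ℝ) (l : Fin 3)
    (f : (Fin 3 → ℤ) → A) : (Fin 3 → ℤ) → A := fun m =>
  if σ then h⁻¹ • (f (m + Pi.single l 1) - f m) else h⁻¹ • (f m - f (m - Pi.single l 1))

/-- Discrete gradient `grad_h^± φ = (∂_h^{±1}φ, ∂_h^{±2}φ, ∂_h^{±3}φ)`. -/
def grad3 (σ : Bool) (h : ℝ) (φ : (Fin 3 → ℤ) → ℝ) : (Fin 3 → ℤ) → (Fin 3 → ℝ) :=
  fun m l => pd σ h l φ m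

/-- Discrete divergence `div_h^± g = Σ_l ∂_h^{±l} g_l`. -/
def div3 (σ : Bool) (h : ℝ) (g : (Fin 3 → ℤ) → (Fin 3 → ℝ)) : (Fin 3 → ℤ) → ℝ :=
  fun m => ∑ l, pd σ h l (fun m' => g m' l) m

/-- Discrete curl
`curl_h^± g = (∂_h^{±2}g₃ − ∂_h^{±3}g₂, ∂_h^{±3}g₁ − ∂_h^{±1}g₃, ∂_h^{±1}g₂ − ∂_h^{±2}g₁)`. -/
def curl3 (σ : Bool) (h : ℝ) (g : (Fin 3 → ℤ) → (Fin 3 → ℝ)) :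
    (Fin 3 → ℤ) → (Fin 3 → ℝ) := fun m =>
  ![pd σ h 1 (fun m' => g m' 2) m - pd σ h 2 (fun m' => g m' 1) m,
    pd σ h 2 (fun m' => g m' 0) m - pd σ h 0 (fun m' => g m' 2) m,
    pd σ h 0 (fun m' => g m' 1) m - pd σ h 1 (fun m' => g m' 0) m]

/-- The discrete Laplacian `(Δ_h f)(m) = Σ_l (f(m+ε_l) + f(m−ε_l) − 2f(m))/h²`,
acting componentwise. -/
def lap3 {A : Type*} [AddCommGroup A] [Module ℝ A] (h : ℝ) (f : (Fin 3 → ℤ) → A) :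
    (Fin 3 → ℤ) → A := fun m =>
  (h ^ 2)⁻¹ • ∑ l, (f (m + Pi.single l 1) + f (m - Pi.single l 1) - (2 : ℝ) • f m)

/-- The quaternion with real part `r` and vector part `v` (a triple of real lattice values
is identified with the pure quaternion `v₁ i + v₂ j + v₃ k`). -/
def toQ (r : ℝ) (v : Fin 3 → ℝ) : ℍ[ℝ] := ⟨r, v 0, v 1, v 2⟩

/-- The vector part `Vec f = (f¹, f², f³)` of a quaternion-valued lattice function. -/
def vecf (f : (Fin 3 → ℤ) → ℍ[ℝ]) : (Fin 3 → ℤ) → (Fin 3 → ℝ) :=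
  fun m => ![(f m).imI, (f m).imJ, (f m).imK]

/-- The difference Dirac operator `D_h^{−+} f = −div_h^− Vec f + grad_h^− f⁰ + curl_h^+ Vec f`. -/
def Dmp (h : ℝ) (f : (Fin 3 → ℤ) → ℍ[ℝ]) : (Fin 3 → ℤ) → ℍ[ℝ] := fun m =>
  toQ (-(div3 false h (vecf f) m))
    (fun l => grad3 false h (fun m' => (f m').re) m l + curl3 true h (vecf f) m l)

/-- The difference Dirac operator `D_h^{+−} f = −div_h^+ Vec f + grad_h^+ f⁰ + curl_h^− Vec f`. -/
def Dpm (h : ℝ) (f : (Fin 3 → ℤ) → ℍ[ℝ]) : (Fin 3 → ℤ) → ℍ[ℝ] := fun m =>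
  toQ (-(div3 true h (vecf f) m))
    (fun l => grad3 true h (fun m' => (f m').re) m l + curl3 false h (vecf f) m l)

/-- The pure quaternion `mh = (m₁h) i + (m₂h) j + (m₃h) k`. -/
def vecQ3 (h : ℝ) (m : Fin 3 → ℤ) : ℍ[ℝ] :=
  toQ 0 (fun l => (m l : ℝ) * h)

/-- The factorial power `(mh)_+^{(α)}` (for `pos = true`, factors `m_l h + k h`) resp.
`(mh)_−^{(α)}` (for `pos = false`, factors `m_l h − k h`). -/
def mfp3 (pos : Bool) (h : ℝ) (m : Fin 3 → ℤ) (α : Fin 3 → ℕ) : ℝ :=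
  ∏ l, ∏ k ∈ range (α l), ((m l : ℝ) * h + (if pos then 1 else -1) * k * h)

/-- `Π_k`: the real span of the lattice functions `m ↦ (mh)^{(α)} a` with `|α| ≤ k`,
`a ∈ ℍ`.  `Π_k^−` is `PiLe3 true h k` (it uses the `(mh)_+` factorial powers), and
`Π_k^+` is `PiLe3 false h k`. -/
def PiLe3 (pos : Bool) (h : ℝ) (k : ℕ) : Submodule ℝ ((Fin 3 → ℤ) → ℍ[ℝ]) :=
  Submodule.span ℝ {f | ∃ (α : Fin 3 → ℕ) (a : ℍ[ℝ]),
    (∑ l, α l) ≤ k ∧ f = fun m => mfp3 pos h m α • a}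

/-- The real span of the lattice functions `m ↦ (mh)^{(α)} a` with `|α| = k`. -/
def PiEq3 (pos : Bool) (h : ℝ) (k : ℕ) : Submodule ℝ ((Fin 3 → ℤ) → ℍ[ℝ]) :=
  Submodule.span ℝ {f | ∃ (α : Fin 3 → ℕ) (a : ℍ[ℝ]),
    (∑ l, α l) = k ∧ f = fun m => mfp3 pos h m α • a}

theorem surjective_of_commutator_filtration {M : Type*} [AddCommGroup M] [Module ℝ M]
    (V : ℕ → Submodule ℝ M) (hV : Monotone V) (hV0 : V 0 = ⊥) (F E : M →ₗ[ℝ] M)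
    (hF : ∀ n, ∀ f ∈ V n, F f ∈ V (n - 2)) (hE : ∀ n, ∀ f ∈ V (n - 2), E f ∈ V n)
    (hG : ∀ n, ∀ f ∈ V n, F (E f) - E (F f) - (4 * n + 2 : ℝ) • f ∈ V (n - 1))
    (n : ℕ) : ∀ c : ℝ, 0 ≤ c → ∀ p ∈ V n, ∃ q ∈ V n, c • q + F (E q) = p := by
  induction n using Nat.strong_induction_on with
  | _ n ih =>
    intro c hc p hp
    rcases Nat.eq_zero_or_pos n with rfl | hn
    · have hp0 : p = 0 := by simpa [hV0] using hp
      exact ⟨0, zero_mem _, by simp [hp0]⟩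
    · have hd : (0 : ℝ) < c + (4 * n + 2) := by positivity
      set d : ℝ := c + (4 * n + 2) with hd_def
      have hw : ∃ w ∈ V (n - 2), d • w + F (E w) = F p :=
        ih (n - 2) (by omega) d hd.le (F p) (hF n p hp)
      obtain ⟨w, hwV, hw⟩ := hw
      set q : M := d⁻¹ • (p - E w) with hq_def
      have hqV : q ∈ V n := (V n).smul_mem _ ((V n).sub_mem hp (hE n w hwV))
      have hFq : F q = w := by
        rw [hq_def, map_smul, map_sub, ← hw, add_sub_cancel_right, inv_smul_smul₀ hd.ne']
      have hdq : d • q = p - E w := smul_inv_smul₀ hd.ne' _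
      obtain ⟨r, hrV, hr⟩ := ih (n - 1) (by omega) c hc _ (hG n q hqV)
      refine ⟨q - r, (V n).sub_mem hqV (hV (Nat.sub_le n 1) hrV), ?_⟩
      have hcq : c • q = p - E w - (4 * n + 2 : ℝ) • q := by
        rw [← hdq, hd_def, add_smul, add_sub_cancel_right]
      rw [hFq] at hr
      rw [smul_sub, map_sub, map_sub, hcq]
      have hFr : F (E r) = F (E q) - E w - (4 * n + 2 : ℝ) • q - c • r := by
        rw [← hr]; abel
      rw [hFr]
      abel

/-- The sign `±1` of the factorial powers, as an integer. -/
def factorialSign (pos : Bool) : ℤ := if pos then 1 else -1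

theorem factorialSign_sq (pos : Bool) :
    (factorialSign pos : ℝ) * factorialSign pos = 1 := by
  cases pos <;> simp [factorialSign]

/-- Translation by `z` steps in direction `l`. -/
def latticeShift (l : Fin 3) (z : ℤ) :
    ((Fin 3 → ℤ) → ℍ[ℝ]) →ₗ[ℝ] ((Fin 3 → ℤ) → ℍ[ℝ]) :=
  LinearMap.funLeft ℝ ℍ[ℝ] (fun m => m + Pi.single l z)

@[simp] theorem latticeShift_apply (l : Fin 3) (z : ℤ) (f : (Fin 3 → ℤ) → ℍ[ℝ])
    (m : Fin 3 → ℤ) : latticeShift l z f m = f (m + Pi.single l z) := rfl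

theorem latticeShift_shift_neg (l : Fin 3) (z : ℤ) (f : (Fin 3 → ℤ) → ℍ[ℝ]) :
    latticeShift l z (latticeShift l (-z) f) = f := by
  funext m
  simp [add_assoc, ← Pi.single_add]

/-- Pointwise multiplication by a real-valued lattice function. -/
def latticeMul (φ : (Fin 3 → ℤ) → ℝ) :
    ((Fin 3 → ℤ) → ℍ[ℝ]) →ₗ[ℝ] ((Fin 3 → ℤ) → ℍ[ℝ]) where
  toFun f m := φ m • f m
  map_add' f g := by funext m; simp
  map_smul' c f := by funext m; simp [smul_comm c]

@[simp] theorem latticeMul_apply (φ : (Fin 3 → ℤ) → ℝ) (f : (Fin 3 → ℤ) → ℍ[ℝ])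
    (m : Fin 3 → ℤ) : latticeMul φ f m = φ m • f m := rfl

/-- Multiplication by the coordinate `m_l h`. -/
abbrev coordMul (h : ℝ) (l : Fin 3) := latticeMul (fun m => (m l : ℝ) * h)

/-- Multiplication by `|mh|²`. -/
abbrev normSqMul (h : ℝ) := latticeMul (fun m => ∑ l, ((m l : ℝ) * h) ^ 2)

/-- The difference operator `f ↦ f(· ∓ ε_l) - f` adapted to the factorial powers. -/
def latticeDiff (pos : Bool) (l : Fin 3) :
    ((Fin 3 → ℤ) → ℍ[ℝ]) →ₗ[ℝ] ((Fin 3 → ℤ) → ℍ[ℝ]) :=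
  latticeShift l (-factorialSign pos) - LinearMap.id

theorem latticeDiff_apply (pos : Bool) (l : Fin 3) (f : (Fin 3 → ℤ) → ℍ[ℝ]) :
    latticeDiff pos l f = latticeShift l (-factorialSign pos) f - f := rfl

/-- The discrete Laplacian as a linear map. -/
def latticeLap (h : ℝ) : ((Fin 3 → ℤ) → ℍ[ℝ]) →ₗ[ℝ] ((Fin 3 → ℤ) → ℍ[ℝ]) :=
  (h ^ 2)⁻¹ • ∑ l, (latticeShift l 1 + latticeShift l (-1) - (2 : ℝ) • LinearMap.id)

theorem latticeLap_eq_lap3 (h : ℝ) (f : (Fin 3 → ℤ) → ℍ[ℝ]) :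
    latticeLap h f = lap3 h f := by
  funext m
  simp [latticeLap, lap3, LinearMap.sum_apply, Pi.single_neg, sub_eq_add_neg]

/-- The lattice function `m ↦ (mh)^{(α)} a`. -/
def factorialMonomial (pos : Bool) (h : ℝ) (α : Fin 3 → ℕ) (a : ℍ[ℝ]) :
    (Fin 3 → ℤ) → ℍ[ℝ] := fun m => mfp3 pos h m α • a

theorem mfp3_add_single (pos : Bool) (h : ℝ) (m : Fin 3 → ℤ) (β : Fin 3 → ℕ) (l : Fin 3) :
    mfp3 pos h m (β + Pi.single l 1) =
      ((m l : ℝ) * h + factorialSign pos * β l * h) * mfp3 pos h m β := by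
  fin_cases l <;> cases pos <;>
    simp [mfp3, Fin.prod_univ_three, prod_range_succ, factorialSign] <;> ring

theorem mfp3_shift_add_single (pos : Bool) (h : ℝ) (m : Fin 3 → ℤ) (β : Fin 3 → ℕ)
    (l : Fin 3) :
    mfp3 pos h (m + Pi.single l (-factorialSign pos)) (β + Pi.single l 1) =
      ((m l : ℝ) * h - factorialSign pos * h) * mfp3 pos h m β := by
  have key (z : ℤ) (n : ℕ) :
      ∏ k ∈ range (n + 1), (((z + -factorialSign pos : ℤ) : ℝ) * h +
        (if pos then 1 else -1) * k * h) =
      ((z : ℝ) * h - factorialSign pos * h) *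
        ∏ k ∈ range n, ((z : ℝ) * h + (if pos then 1 else -1) * k * h) := by
    rw [prod_range_succ', mul_comm]
    congr 1
    · push_cast; ring
    · refine prod_congr rfl fun k _ => ?_
      cases pos <;> simp [factorialSign] <;> ring
  unfold mfp3
  rw [← mul_prod_erase univ _ (mem_univ l), ← mul_prod_erase univ _ (mem_univ l), ← mul_assoc]
  congr 1
  · simp only [Pi.add_apply, Pi.single_eq_same, key]
  · refine prod_congr rfl fun i hi => ?_
    simp [ne_of_mem_erase hi]

theorem mfp3_shift_of_eq_zero (pos : Bool) (h : ℝ) (m : Fin 3 → ℤ) (α : Fin 3 → ℕ)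
    (l : Fin 3) (hl : α l = 0) (z : ℤ) :
    mfp3 pos h (m + Pi.single l z) α = mfp3 pos h m α := by
  unfold mfp3
  refine prod_congr rfl fun i _ => ?_
  by_cases hi : i = l
  · subst hi; simp [hl]
  · simp [hi]

theorem coordMul_factorialMonomial (pos : Bool) (h : ℝ) (β : Fin 3 → ℕ) (a : ℍ[ℝ])
    (l : Fin 3) :
    coordMul h l (factorialMonomial pos h β a) =
      factorialMonomial pos h (β + Pi.single l 1) a -
        (factorialSign pos * β l * h : ℝ) • factorialMonomial pos h β a := by
  funext m
  simp only [latticeMul_apply, factorialMonomial, mfp3_add_single, Pi.sub_apply, Pi.smul_apply]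
  module

theorem latticeDiff_factorialMonomial_add_single (pos : Bool) (h : ℝ) (β : Fin 3 → ℕ)
    (a : ℍ[ℝ]) (l : Fin 3) :
    latticeDiff pos l (factorialMonomial pos h (β + Pi.single l 1) a) =
      (-(factorialSign pos * h * (β l + 1)) : ℝ) • factorialMonomial pos h β a := by
  funext m
  simp only [latticeDiff_apply, latticeShift_apply, factorialMonomial, Pi.sub_apply,
    Pi.smul_apply]
  rw [mfp3_shift_add_single, mfp3_add_single]
  module

theorem latticeDiff_factorialMonomial_of_eq_zero (pos : Bool) (h : ℝ) (α : Fin 3 → ℕ)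
    (a : ℍ[ℝ]) (l : Fin 3) (hl : α l = 0) :
    latticeDiff pos l (factorialMonomial pos h α a) = 0 := by
  funext m
  simp [latticeDiff_apply, factorialMonomial, mfp3_shift_of_eq_zero pos h m α l hl]

theorem exists_eq_add_single {α : Fin 3 → ℕ} {l : Fin 3} (hl : α l ≠ 0) :
    ∃ β : Fin 3 → ℕ, α = β + Pi.single l 1 := by
  refine ⟨α - Pi.single l 1, ?_⟩
  funext i
  by_cases hi : i = l
  · subst hi; simp; omega
  · simp [hi]

theorem sum_add_single (β : Fin 3 → ℕ) (l : Fin 3) :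
    ∑ i, (β + Pi.single l 1 : Fin 3 → ℕ) i = ∑ i, β i + 1 := by
  simp [sum_add_distrib]

/-- The span of the factorial monomials of degree `< n`. -/
def degLT (pos : Bool) (h : ℝ) (n : ℕ) : Submodule ℝ ((Fin 3 → ℤ) → ℍ[ℝ]) :=
  Submodule.span ℝ {f | ∃ (α : Fin 3 → ℕ) (a : ℍ[ℝ]),
    (∑ l, α l) < n ∧ f = factorialMonomial pos h α a}

section degLT

variable {pos : Bool} {h : ℝ}

theorem degLT_succ (k : ℕ) : degLT pos h (k + 1) = PiLe3 pos h k := by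
  simp only [degLT, PiLe3, Nat.lt_succ_iff]
  rfl

theorem degLT_zero : degLT pos h 0 = ⊥ := by
  simp [degLT]

theorem degLT_mono : Monotone (degLT pos h) := fun _ _ hn =>
  Submodule.span_mono fun _ ⟨α, a, hα, hf⟩ => ⟨α, a, hα.trans_le hn, hf⟩

theorem factorialMonomial_mem_degLT {n : ℕ} {α : Fin 3 → ℕ} (hα : ∑ l, α l < n) (a : ℍ[ℝ]) :
    factorialMonomial pos h α a ∈ degLT pos h n :=
  Submodule.subset_span ⟨α, a, hα, rfl⟩

theorem map_mem_degLT {n k : ℕ} (T : ((Fin 3 → ℤ) → ℍ[ℝ]) →ₗ[ℝ] ((Fin 3 → ℤ) → ℍ[ℝ]))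
    (hT : ∀ α a, ∑ l, α l < n → T (factorialMonomial pos h α a) ∈ degLT pos h k)
    {f : (Fin 3 → ℤ) → ℍ[ℝ]} (hf : f ∈ degLT pos h n) : T f ∈ degLT pos h k := by
  have : degLT pos h n ≤ (degLT pos h k).comap T := by
    refine Submodule.span_le.2 ?_
    rintro _ ⟨α, a, hα, rfl⟩
    exact hT α a hα
  exact this hf

theorem coordMul_mem_degLT {n : ℕ} (l : Fin 3) {f : (Fin 3 → ℤ) → ℍ[ℝ]}
    (hf : f ∈ degLT pos h n) : coordMul h l f ∈ degLT pos h (n + 1) := by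
  refine map_mem_degLT _ (fun α a hα => ?_) hf
  rw [coordMul_factorialMonomial]
  refine Submodule.sub_mem _ (factorialMonomial_mem_degLT ?_ a)
    (Submodule.smul_mem _ _ (factorialMonomial_mem_degLT (by omega) a))
  rw [sum_add_single]; omega

theorem coordMul_mem_degLT_pred {n : ℕ} (l : Fin 3) {f : (Fin 3 → ℤ) → ℍ[ℝ]}
    (hf : f ∈ degLT pos h (n - 1)) : coordMul h l f ∈ degLT pos h n := by
  rcases n with _ | n
  · have : f = 0 := by simpa [degLT_zero] using hf
    simp [this]
  · exact coordMul_mem_degLT l hf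

theorem latticeDiff_mem_degLT {n : ℕ} (l : Fin 3) {f : (Fin 3 → ℤ) → ℍ[ℝ]}
    (hf : f ∈ degLT pos h n) : latticeDiff pos l f ∈ degLT pos h (n - 1) := by
  refine map_mem_degLT _ (fun α a hα => ?_) hf
  by_cases hl : α l = 0
  · rw [latticeDiff_factorialMonomial_of_eq_zero pos h α a l hl]
    exact zero_mem _
  · obtain ⟨β, rfl⟩ := exists_eq_add_single hl
    rw [sum_add_single] at hα
    rw [latticeDiff_factorialMonomial_add_single]
    exact Submodule.smul_mem _ _ (factorialMonomial_mem_degLT (by omega) a)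

theorem latticeShift_eq_sub (l : Fin 3) (f : (Fin 3 → ℤ) → ℍ[ℝ]) :
    latticeShift l (factorialSign pos) f =
      f - latticeShift l (factorialSign pos) (latticeDiff pos l f) := by
  rw [latticeDiff_apply, map_sub, latticeShift_shift_neg]
  abel

theorem latticeShift_mem_degLT {n : ℕ} (l : Fin 3) {f : (Fin 3 → ℤ) → ℍ[ℝ]}
    (hf : f ∈ degLT pos h n) :
    latticeShift l (factorialSign pos) f ∈ degLT pos h n := by
  induction n generalizing f with
  | zero =>
    have : f = 0 := by simpa [degLT_zero] using hf
    simp [this]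
  | succ n ih =>
    rw [latticeShift_eq_sub]
    exact Submodule.sub_mem _ hf
      (degLT_mono (Nat.le_succ n) (ih (latticeDiff_mem_degLT (n := n + 1) l hf)))

/-- The second difference in direction `l`. -/
def secondDiff (pos : Bool) (l : Fin 3) (f : (Fin 3 → ℤ) → ℍ[ℝ]) : (Fin 3 → ℤ) → ℍ[ℝ] :=
  latticeShift l (factorialSign pos) (latticeDiff pos l (latticeDiff pos l f))

theorem secondDiff_mem_degLT {n : ℕ} (l : Fin 3) {f : (Fin 3 → ℤ) → ℍ[ℝ]}
    (hf : f ∈ degLT pos h n) : secondDiff pos l f ∈ degLT pos h (n - 1 - 1) := by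
  unfold secondDiff
  exact latticeShift_mem_degLT l (latticeDiff_mem_degLT l (latticeDiff_mem_degLT l hf))

theorem secondDiff_apply (l : Fin 3) (f : (Fin 3 → ℤ) → ℍ[ℝ]) (m : Fin 3 → ℤ) :
    secondDiff pos l f m =
      f (m + Pi.single l 1) + f (m + Pi.single l (-1)) - (2 : ℝ) • f m := by
  cases pos <;>
    simp [secondDiff, latticeDiff_apply, factorialSign, Pi.single_neg, two_smul] <;> abel

theorem latticeLap_eq_secondDiff (f : (Fin 3 → ℤ) → ℍ[ℝ]) :
    latticeLap h f = (h ^ 2)⁻¹ • ∑ l, secondDiff pos l f := by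
  funext m
  simp [latticeLap, LinearMap.sum_apply, secondDiff_apply]

theorem latticeLap_mem_degLT {n : ℕ} {f : (Fin 3 → ℤ) → ℍ[ℝ]} (hf : f ∈ degLT pos h n) :
    latticeLap h f ∈ degLT pos h (n - 2) := by
  rw [latticeLap_eq_secondDiff (pos := pos)]
  refine Submodule.smul_mem _ _ (Submodule.sum_mem _ fun l _ => ?_)
  rw [show n - 2 = n - 1 - 1 by omega]
  exact secondDiff_mem_degLT l hf

theorem normSqMul_eq_sum (f : (Fin 3 → ℤ) → ℍ[ℝ]) :
    normSqMul h f = ∑ l, coordMul h l (coordMul h l f) := by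
  funext m
  simp [sum_smul, smul_smul, sq]

theorem normSqMul_mem_degLT {n : ℕ} {f : (Fin 3 → ℤ) → ℍ[ℝ]}
    (hf : f ∈ degLT pos h (n - 2)) : normSqMul h f ∈ degLT pos h n := by
  rw [normSqMul_eq_sum]
  exact Submodule.sum_mem _ fun l _ =>
    coordMul_mem_degLT_pred l (coordMul_mem_degLT_pred l hf)

theorem euler_factorialMonomial (hh : h ≠ 0) (α : Fin 3 → ℕ) (a : ℍ[ℝ]) (l : Fin 3) :
    (-(factorialSign pos * h⁻¹) : ℝ) •
        coordMul h l (latticeDiff pos l (factorialMonomial pos h α a)) -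
      (α l : ℝ) • factorialMonomial pos h α a ∈ degLT pos h (∑ i, α i) := by
  by_cases hl : α l = 0
  · simp [latticeDiff_factorialMonomial_of_eq_zero pos h α a l hl, hl]
  · obtain ⟨β, rfl⟩ := exists_eq_add_single hl
    have hc : (-(factorialSign pos * h⁻¹) : ℝ) * -(factorialSign pos * h * (β l + 1)) =
        β l + 1 := by
      linear_combination (β l + 1 : ℝ) * (h⁻¹ * h) * factorialSign_sq pos +
        (β l + 1 : ℝ) * inv_mul_cancel₀ hh
    rw [latticeDiff_factorialMonomial_add_single, map_smul, smul_smul, hc,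
      coordMul_factorialMonomial, sum_add_single, smul_sub]
    simp only [Pi.add_apply, Pi.single_eq_same, Nat.cast_add, Nat.cast_one]
    rw [sub_sub_cancel_left]
    exact Submodule.neg_mem _ (Submodule.smul_mem _ _ (Submodule.smul_mem _ _
      (factorialMonomial_mem_degLT (Nat.lt_succ_self _) a)))

theorem euler_mem_degLT (hh : h ≠ 0) {n : ℕ} {f : (Fin 3 → ℤ) → ℍ[ℝ]}
    (hf : f ∈ degLT pos h n) :
    ∑ l, (-(factorialSign pos * h⁻¹) : ℝ) • coordMul h l (latticeDiff pos l f) -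
      (n - 1 : ℝ) • f ∈ degLT pos h (n - 1) := by
  have := map_mem_degLT (pos := pos) (h := h) (n := n) (k := n - 1)
    (∑ l, (-(factorialSign pos * h⁻¹) : ℝ) • (coordMul h l ∘ₗ latticeDiff pos l) -
      (n - 1 : ℝ) • LinearMap.id) (fun α a hα => ?_) hf
  · simpa [LinearMap.sum_apply] using this
  · have hsplit : (∑ l, (-(factorialSign pos * h⁻¹) : ℝ) • (coordMul h l ∘ₗ latticeDiff pos l) -
        (n - 1 : ℝ) • LinearMap.id : ((Fin 3 → ℤ) → ℍ[ℝ]) →ₗ[ℝ] ((Fin 3 → ℤ) → ℍ[ℝ])) (factorialMonomial pos h α a) =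
        ∑ l, ((-(factorialSign pos * h⁻¹) : ℝ) •
            coordMul h l (latticeDiff pos l (factorialMonomial pos h α a)) -
          (α l : ℝ) • factorialMonomial pos h α a) +
        ((∑ l, α l : ℕ) + 1 - n : ℝ) • factorialMonomial pos h α a := by
      simp only [LinearMap.sub_apply, LinearMap.sum_apply, LinearMap.smul_apply,
        LinearMap.comp_apply, LinearMap.id_apply, sum_sub_distrib, ← sum_smul, Nat.cast_sum]
      module
    rw [hsplit]
    refine Submodule.add_mem _ (Submodule.sum_mem _ fun l _ =>
      degLT_mono (by omega) (euler_factorialMonomial hh α a l)) ?_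
    rcases eq_or_ne (∑ l, α l + 1) n with hn | hn
    · rw [← hn]; simp
    · exact Submodule.smul_mem _ _ (factorialMonomial_mem_degLT (by omega) a)

theorem latticeLap_normSqMul_commutator (hh : h ≠ 0) (f : (Fin 3 → ℤ) → ℍ[ℝ]) :
    latticeLap h (normSqMul h f) - normSqMul h (latticeLap h f) =
      (6 : ℝ) • f +
      (4 : ℝ) • ∑ l, (-(factorialSign pos * h⁻¹) : ℝ) • coordMul h l (latticeDiff pos l f) +
      ∑ l, ((2 * factorialSign pos * h⁻¹ : ℝ) • coordMul h l (secondDiff pos l f) +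
        secondDiff pos l f) := by
  funext m
  simp only [latticeLap_eq_secondDiff (pos := pos), Fin.sum_univ_three, Pi.add_apply,
    Pi.sub_apply, Pi.smul_apply, latticeMul_apply, secondDiff_apply, latticeDiff_apply,
    latticeShift_apply]
  cases pos <;> simp [factorialSign] <;> match_scalars <;> field_simp <;> ring

theorem commutator_mem_degLT (hh : h ≠ 0) {n : ℕ} {f : (Fin 3 → ℤ) → ℍ[ℝ]}
    (hf : f ∈ degLT pos h n) :
    latticeLap h (normSqMul h f) - normSqMul h (latticeLap h f) - (4 * n + 2 : ℝ) • f ∈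
      degLT pos h (n - 1) := by
  have hsplit : latticeLap h (normSqMul h f) - normSqMul h (latticeLap h f) -
      (4 * n + 2 : ℝ) • f =
      (4 : ℝ) • (∑ l, (-(factorialSign pos * h⁻¹) : ℝ) • coordMul h l (latticeDiff pos l f) -
        (n - 1 : ℝ) • f) +
      ∑ l, ((2 * factorialSign pos * h⁻¹ : ℝ) • coordMul h l (secondDiff pos l f) +
        secondDiff pos l f) := by
    rw [latticeLap_normSqMul_commutator (pos := pos) hh]
    module
  rw [hsplit]
  refine Submodule.add_mem _ (Submodule.smul_mem _ _ (euler_mem_degLT hh hf))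
    (Submodule.sum_mem _ fun l _ => ?_)
  have h2 := secondDiff_mem_degLT l hf
  exact Submodule.add_mem _ (Submodule.smul_mem _ _ (coordMul_mem_degLT_pred l h2))
    (degLT_mono (Nat.sub_le _ _) h2)

theorem exists_harmonic_add_normSqMul (hh : h ≠ 0) {n : ℕ} {P : (Fin 3 → ℤ) → ℍ[ℝ]}
    (hP : P ∈ degLT pos h n) :
    ∃ H ∈ degLT pos h n, ∃ Q ∈ degLT pos h (n - 2),
      lap3 h H = 0 ∧ P = H + normSqMul h Q := by
  obtain ⟨Q, hQ, hFQ⟩ := surjective_of_commutator_filtration (degLT pos h) degLT_mono degLT_zero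
    (latticeLap h) (normSqMul h) (fun _ _ => latticeLap_mem_degLT)
    (fun _ _ => normSqMul_mem_degLT) (fun _ _ => commutator_mem_degLT hh) (n - 2) 0 le_rfl
    (latticeLap h P) (latticeLap_mem_degLT hP)
  refine ⟨P - normSqMul h Q, Submodule.sub_mem _ hP (normSqMul_mem_degLT hQ), Q, hQ, ?_, ?_⟩
  · rw [← latticeLap_eq_lap3, map_sub, ← hFQ]
    simp
  · abel

end degLT

/-- Theorem 4.2 (Fischer decomposition for the discrete Laplacian): every `P ∈ Π_k^±`
decomposes as `P = Σ_{2s ≤ k} |mh|^{2s} 𝓗_{k−2s}` with `𝓗_{k−2s} ∈ Π_{k−2s}^±`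
discrete harmonic, where `|mh|² = (m₁h)² + (m₂h)² + (m₃h)²`. -/
theorem fischer_decomposition_laplacian (h : ℝ) (hh : 0 < h) (pos : Bool) (k : ℕ)
    (P : (Fin 3 → ℤ) → ℍ[ℝ]) (hP : P ∈ PiLe3 pos h k) :
    ∃ H : ℕ → ((Fin 3 → ℤ) → ℍ[ℝ]),
      (∀ s, 2 * s ≤ k → H s ∈ PiLe3 pos h (k - 2 * s) ∧ lap3 h (H s) = 0) ∧
      P = fun m => ∑ s ∈ range (k / 2 + 1), ((∑ l, ((m l : ℝ) * h) ^ 2) ^ s) • H s m := by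
  induction k using Nat.strong_induction_on generalizing P with
  | _ k ih =>
    rw [← degLT_succ] at hP
    obtain ⟨H₀, hH₀, Q, hQ, hlap, rfl⟩ := exists_harmonic_add_normSqMul hh.ne' hP
    rw [degLT_succ] at hH₀
    rcases lt_or_ge k 2 with hk | hk
    · have hQ0 : Q = 0 := by
        rw [show k + 1 - 2 = 0 by omega, degLT_zero] at hQ
        simpa using hQ
      refine ⟨fun _ => H₀, fun s hs => ?_, ?_⟩
      · obtain rfl : s = 0 := by omega
        exact ⟨hH₀, hlap⟩
      · rw [show k / 2 + 1 = 1 by omega]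
        funext m
        simp [hQ0]
    · obtain ⟨j, rfl⟩ := Nat.exists_eq_add_of_le' hk
      rw [show j + 2 + 1 - 2 = j + 1 by omega, degLT_succ] at hQ
      obtain ⟨H, hH, hsum⟩ := ih j (by omega) Q hQ
      refine ⟨fun s => Nat.casesOn s H₀ H, fun s hs => ?_, ?_⟩
      · rcases s with _ | s
        · exact ⟨hH₀, hlap⟩
        · rw [show j + 2 - 2 * (s + 1) = j - 2 * s by omega]
          exact hH s (by omega)
      · funext m
        rw [show (j + 2) / 2 + 1 = j / 2 + 1 + 1 by omega, sum_range_succ', add_comm]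
        simp [hsum, smul_sum, smul_smul, pow_succ']
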